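/- For every real number a ≥ 1, every non-real zero of φ₀(a,·) lies on the critical line: if s ∈ ℂ satisfies Im(s) ≠ 0 and φ₀(a,s) = 0, then Re(s) = 1/2. -/

import Mathlib

open Complex

/-- The constant term `φ₀(a,s) = Λ(2s) a^s + Λ(2s-1) a^{1-s}` of the completed
nonholomorphic Eisenstein series for the modular group, where `Λ` is the completed
Riemann zeta function. -/
noncomputable def phi0 (a : ℝ) (s : ℂ) : ℂ :=
  completedRiemannZeta (2 * s) * (a : ℂ) ^ s +
    completedRiemannZeta (2 * s - 1) * (a : ℂ) ^ (1 - s)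

section

open Set Filter Topology MeasureTheory Metric Bornology
open scoped ComplexConjugate Real

/-- A holomorphic map of the unit disc into the closed unit disc with two distinct fixed points
fixes the origin. -/
theorem map_zero_eq_zero_of_two_fixed_points {f : ℂ → ℂ} {z₁ z₂ : ℂ}
    (hd : DifferentiableOn ℂ f (ball 0 1)) (hf : ∀ z ∈ ball (0 : ℂ) 1, ‖f z‖ ≤ 1)
    (h₁ : z₁ ∈ ball (0 : ℂ) 1) (h₂ : z₂ ∈ ball (0 : ℂ) 1) (hne : z₁ ≠ z₂)
    (hf₁ : f z₁ = z₁) (hf₂ : f z₂ = z₂) : f 0 = 0 := by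
  have hlt : ∀ z ∈ ball (0 : ℂ) 1, ‖f z‖ < 1 := by
    intro z hz
    refine lt_of_le_of_ne (hf z hz) fun h => hne ?_
    have hconst := Complex.eqOn_of_isPreconnected_of_isMaxOn_norm
      (convex_ball (0 : ℂ) 1).isPreconnected isOpen_ball hd hz
      (fun w hw => by simpa [h] using hf w hw)
    rw [← hf₁, ← hf₂, hconst h₁, hconst h₂]
    rfl
  set φ : ℂ → ℂ := fun z => (z₁ - z) / (1 - conj z₁ * z) with hφ
  rw [mem_ball_zero_iff] at h₁ h₂
  have hden : ∀ z : ℂ, ‖z‖ < 1 → 1 - conj z₁ * z ≠ 0 := by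
    intro z hz h
    have h1 : ‖conj z₁ * z‖ = 1 := by rw [← sub_eq_zero.mp h]; simp
    rw [norm_mul, RCLike.norm_conj] at h1
    nlinarith [norm_nonneg z, norm_nonneg z₁]
  have hφ_lt : ∀ z : ℂ, ‖z‖ < 1 → ‖φ z‖ < 1 := by
    intro z hz
    have hd0 := norm_pos_iff.mpr (hden z hz)
    rw [hφ]
    simp only [norm_div]
    rw [div_lt_one hd0, ← sq_lt_sq₀ (norm_nonneg _) (norm_nonneg _)]
    have e : ‖1 - conj z₁ * z‖ ^ 2 - ‖z₁ - z‖ ^ 2 = (1 - ‖z₁‖ ^ 2) * (1 - ‖z‖ ^ 2) := by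
      simp only [← Complex.normSq_eq_norm_sq, Complex.normSq_apply]
      simp
      ring
    have : 0 < (1 - ‖z₁‖ ^ 2) * (1 - ‖z‖ ^ 2) := by
      apply mul_pos <;> nlinarith [norm_nonneg z, norm_nonneg z₁]
    linarith
  have hφ_inv : ∀ z : ℂ, ‖z‖ < 1 → φ (φ z) = z := by
    intro z hz
    have hd1 := hden z hz
    have hd2 := hden (φ z) (hφ_lt z hz)
    have e : 1 - conj z₁ * z₁ ≠ 0 := hden z₁ h₁
    change (z₁ - φ z) / (1 - conj z₁ * φ z) = z
    rw [div_eq_iff hd2]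
    have hφz : φ z * (1 - conj z₁ * z) = z₁ - z := div_mul_cancel₀ _ hd1
    linear_combination -hφz
  have hφ0 : φ 0 = z₁ := by simp [hφ]
  have hφ1 : φ z₁ = 0 := by simp [hφ]
  have hφd : DifferentiableOn ℂ φ (ball 0 1) := by
    intro z hz
    have := hden z (mem_ball_zero_iff.mp hz)
    exact DifferentiableAt.differentiableWithinAt (by fun_prop (disch := assumption))
  have hmφ : MapsTo φ (ball 0 1) (ball 0 1) := fun z hz => by
    simpa using hφ_lt z (by simpa using hz)
  have hmf : MapsTo f (ball 0 1) (ball 0 1) := fun z hz => by simpa using hlt z hz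
  set g : ℂ → ℂ := fun z => φ (f (φ z)) with hg
  have hgd : DifferentiableOn ℂ g (ball 0 1) :=
    hφd.comp (hd.comp hφd hmφ) (hmf.comp hmφ)
  have hg0 : g 0 = 0 := by simp only [hg, hφ0, hf₁, hφ1]
  have hgm : MapsTo g (ball 0 1) (closedBall (g 0) 1) := by
    rw [hg0]
    exact ((hmφ.comp hmf).comp hmφ).mono_right ball_subset_closedBall
  set z₃ := φ z₂ with hz₃
  have hz₃b : z₃ ∈ ball (0 : ℂ) 1 := hmφ (by simpa using h₂)
  have hg3 : g z₃ = z₃ := by simp only [hg, hz₃, hφ_inv z₂ h₂, hf₂]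
  have hz₃_ne : z₃ ≠ 0 := by
    intro h
    apply hne
    rw [← hφ0, ← h, hz₃, hφ_inv z₂ h₂]
  have hds : dslope g 0 z₃ = 1 := by
    rw [dslope_of_ne _ hz₃_ne, slope_def_field, hg0, hg3]
    simp [hz₃_ne]
  have haff := Complex.affine_of_mapsTo_ball_of_norm_dslope_eq_div hgd hgm hz₃b (by simp [hds])
  have h := haff (show z₁ ∈ ball (0 : ℂ) 1 by simpa using h₁)
  simp only [hg0, hds, sub_zero, smul_eq_mul, mul_one, zero_add] at h
  simp only [hg, hφ1] at h
  have h' := congrArg φ h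
  rwa [hφ_inv _ (hlt 0 (by simp)), hφ1] at h'

theorem apply_half_eq_zero_of_eq_cayley {T : ℂ → ℂ} {p q : ℂ}
    (hd : DifferentiableOn ℂ T {w | 0 < w.re}) (hT : ∀ w : ℂ, 0 < w.re → ‖T w‖ ≤ 1)
    (hp : 0 < p.re) (hq : 0 < q.re) (hpq : p ≠ q)
    (hTp : (p + 1 / 2) * T p = -(p - 1 / 2)) (hTq : (q + 1 / 2) * T q = -(q - 1 / 2)) :
    T (1 / 2) = 0 := by
  set ψ : ℂ → ℂ := fun z => (1 + z) / (2 * (1 - z)) with hψ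
  have hden : ∀ z ∈ ball (0 : ℂ) 1, 1 - z ≠ 0 := by
    intro z hz h
    rw [← sub_eq_zero.mp h] at hz
    simp at hz
  have hψd : DifferentiableOn ℂ ψ (ball 0 1) := by
    intro z hz
    have : 2 * (1 - z) ≠ 0 := mul_ne_zero two_ne_zero (hden z hz)
    exact DifferentiableAt.differentiableWithinAt (by fun_prop (disch := assumption))
  have hψm : MapsTo ψ (ball 0 1) {w | 0 < w.re} := by
    intro z hz
    have h0 := hden z hz
    have e : ψ z = (1 + z) * conj (1 - z) / (2 * ‖1 - z‖ ^ 2 : ℝ) := by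
      push_cast
      rw [← Complex.mul_conj']
      have : conj (1 - z) ≠ 0 := (map_ne_zero _).mpr h0
      simp only [hψ]
      field_simp
    have hz' : ‖z‖ < 1 := by simpa using hz
    have hn : z.re * z.re + z.im * z.im < 1 := by
      rw [← Complex.normSq_apply, Complex.normSq_eq_norm_sq]
      nlinarith [norm_nonneg z]
    have : 0 < ‖1 - z‖ := norm_pos_iff.mpr h0
    rw [mem_ofPred_eq, e, Complex.div_ofReal_re]
    apply div_pos _ (by positivity)
    simp
    nlinarith
  have hB : ∀ w : ℂ, 0 < w.re → (w + 1 / 2 ≠ 0 ∧ (w - 1 / 2) / (w + 1 / 2) ∈ ball (0 : ℂ) 1 ∧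
      ψ ((w - 1 / 2) / (w + 1 / 2)) = w) := by
    intro w hw
    have h0 : w + 1 / 2 ≠ 0 := by
      intro h
      have := congrArg Complex.re h
      simp at this
      linarith
    have h0' : w * 2 + 1 ≠ 0 := fun h => h0 (by linear_combination h / 2)
    refine ⟨h0, ?_, ?_⟩
    · rw [mem_ball_zero_iff, norm_div, div_lt_one (norm_pos_iff.mpr h0),
        ← sq_lt_sq₀ (norm_nonneg _) (norm_nonneg _), ← Complex.normSq_eq_norm_sq,
        ← Complex.normSq_eq_norm_sq, Complex.normSq_apply, Complex.normSq_apply]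
      simp
      nlinarith
    · have e : 2 * (1 - (w - 1 / 2) / (w + 1 / 2)) = 2 / (w + 1 / 2) := by
        rw [one_sub_div h0, ← mul_div_assoc]
        congr 1
        ring
      simp only [hψ]
      rw [e]
      field_simp
      ring
  obtain ⟨hp0, hpb, hpψ⟩ := hB p hp
  obtain ⟨hq0, hqb, hqψ⟩ := hB q hq
  have key := map_zero_eq_zero_of_two_fixed_points (f := fun z => -T (ψ z))
    (hd.comp hψd hψm).neg (fun z hz => by simpa using hT _ (hψm hz)) hpb hqb
    (fun h => hpq (by rw [← hpψ, ← hqψ, h]))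
    (by simp only [hpψ]; rw [eq_div_iff hp0]; linear_combination -hTp)
    (by simp only [hqψ]; rw [eq_div_iff hq0]; linear_combination -hTq)
  simpa [hψ] using key

/-- The entire function `ξ(z) = z (z - 1) Λ(z)`, in terms of the entire part of `Λ`. -/
noncomputable def entireXi (z : ℂ) : ℂ := z * (z - 1) * completedRiemannZeta₀ z + 1

theorem differentiable_entireXi : Differentiable ℂ entireXi := by
  have := differentiable_completedZeta₀
  unfold entireXi
  fun_prop

theorem entireXi_one_sub (z : ℂ) : entireXi (1 - z) = entireXi z := by
  simp only [entireXi, completedRiemannZeta₀_one_sub]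
  ring

theorem entireXi_eq {z : ℂ} (h₀ : z ≠ 0) (h₁ : z ≠ 1) :
    entireXi z = z * (z - 1) * completedRiemannZeta z := by
  have : 1 - z ≠ 0 := sub_ne_zero.mpr h₁.symm
  rw [entireXi, completedRiemannZeta_eq]
  field_simp
  ring

theorem completedRiemannZeta_eq_Gammaℝ_mul {z : ℂ} (h : 0 < z.re) :
    completedRiemannZeta z = Gammaℝ z * riemannZeta z := by
  have h0 : z ≠ 0 := by rintro rfl; simp at h
  rw [riemannZeta_def_of_ne_zero h0, mul_div_cancel₀ _ (Gammaℝ_ne_zero_of_re_pos h)]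

theorem entireXi_ne_zero {z : ℂ} (h : 1 ≤ z.re) : entireXi z ≠ 0 := by
  rcases eq_or_ne z 1 with rfl | h1
  · simp [entireXi]
  have h0 : z ≠ 0 := by rintro rfl; norm_num at h
  have hp : 0 < z.re := by linarith
  rw [entireXi_eq h0 h1, completedRiemannZeta_eq_Gammaℝ_mul hp]
  exact mul_ne_zero (mul_ne_zero h0 (sub_ne_zero.mpr h1))
    (mul_ne_zero (Gammaℝ_ne_zero_of_re_pos hp) (riemannZeta_ne_zero_of_one_le_re h))

theorem completedRiemannZeta₀_conj (z : ℂ) :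
    completedRiemannZeta₀ (conj z) = conj (completedRiemannZeta₀ z) := by
  have hf : ∀ x, conj ((HurwitzZeta.hurwitzEvenFEPair 0).f_modif x) =
      (HurwitzZeta.hurwitzEvenFEPair 0).f_modif x := by
    intro x
    simp only [WeakFEPair.f_modif, HurwitzZeta.hurwitzEvenFEPair, Pi.add_apply, indicator_apply,
      map_add]
    split_ifs <;> simp
  simp only [completedRiemannZeta₀, HurwitzZeta.completedHurwitzZetaEven₀, WeakFEPair.Λ₀, mellin,
    map_div₀, map_ofNat]
  rw [← integral_conj]
  congr 1
  refine setIntegral_congr_fun measurableSet_Ioi fun t (ht : 0 < t) => ?_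
  simp only [smul_eq_mul, map_mul, hf]
  have harg : (t : ℂ).arg ≠ π := by
    simp [Complex.arg_ofReal_of_nonneg ht.le, Real.pi_pos.ne]
  have h := Complex.cpow_conj (t : ℂ) (z / 2 - 1) harg
  rw [Complex.conj_ofReal] at h
  rw [← h]
  simp [map_ofNat]

theorem entireXi_conj (z : ℂ) : entireXi (conj z) = conj (entireXi z) := by
  simp [entireXi, completedRiemannZeta₀_conj]

theorem exists_norm_completedRiemannZeta₀_le :
    ∃ C : ℝ, ∀ z : ℂ, 0 ≤ z.re → z.re ≤ 2 → ‖completedRiemannZeta₀ z‖ ≤ C := by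
  set P := HurwitzZeta.hurwitzEvenFEPair 0
  have hconv : ∀ s : ℂ, IntegrableOn (fun t : ℝ => ‖(t : ℂ) ^ (s - 1) • P.f_modif t‖) (Ioi 0) :=
    fun s => (P.isStrongFEPair_toStrongFEPair.hasMellin s).1.norm
  refine ⟨(∫ t in Ioi (0 : ℝ), (‖(t : ℂ) ^ ((0 : ℂ) - 1) • P.f_modif t‖ +
    ‖(t : ℂ) ^ ((1 : ℂ) - 1) • P.f_modif t‖)) / 2, fun z h0 h2 => ?_⟩
  simp only [completedRiemannZeta₀, HurwitzZeta.completedHurwitzZetaEven₀, WeakFEPair.Λ₀, mellin]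
  rw [norm_div, Complex.norm_ofNat]
  gcongr
  refine norm_integral_le_of_norm_le ((hconv 0).add (hconv 1)) ?_
  refine (ae_restrict_iff' measurableSet_Ioi).mpr (Eventually.of_forall fun t (ht : 0 < t) => ?_)
  simp only [norm_smul, ← add_mul]
  refine mul_le_mul_of_nonneg_right ?_ (norm_nonneg _)
  rw [norm_cpow_eq_rpow_re_of_pos ht, norm_cpow_eq_rpow_re_of_pos ht,
    norm_cpow_eq_rpow_re_of_pos ht]
  have hre : (z / 2).re = z.re / 2 := by simp
  simp only [sub_re, hre, zero_re, one_re, sub_self, Real.rpow_zero]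
  rcases le_total t 1 with h | h
  · have := Real.rpow_le_rpow_of_exponent_ge ht h (show (0 : ℝ) - 1 ≤ z.re / 2 - 1 by linarith)
    linarith
  · have := Real.rpow_le_one_of_one_le_of_nonpos h (show z.re / 2 - 1 ≤ 0 by linarith)
    exact this.trans (le_add_of_nonneg_left (Real.rpow_nonneg ht.le _))

theorem exists_norm_entireXi_le :
    ∃ C : ℝ, 0 < C ∧ ∀ z : ℂ, 0 ≤ z.re → z.re ≤ 2 → ‖entireXi z‖ ≤ C * Real.exp (2 * ‖z‖) := by
  obtain ⟨C, hC⟩ := exists_norm_completedRiemannZeta₀_le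
  have hC0 : 0 ≤ C := (norm_nonneg _).trans (hC 0 (by simp) (by simp))
  refine ⟨C + 1, by positivity, fun z h0 h2 => ?_⟩
  have h1 : ‖z - 1‖ ≤ 1 + ‖z‖ := by
    have := norm_sub_le z 1
    rw [norm_one] at this
    linarith
  have hz := norm_nonneg z
  have he : (1 + ‖z‖) ^ 2 ≤ Real.exp (2 * ‖z‖) := by
    rw [show 2 * ‖z‖ = ‖z‖ + ‖z‖ by ring, Real.exp_add, ← sq]
    gcongr
    linarith [Real.add_one_le_exp ‖z‖]
  calc ‖entireXi z‖ ≤ ‖z‖ * ‖z - 1‖ * ‖completedRiemannZeta₀ z‖ + 1 := by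
        refine (norm_add_le _ _).trans ?_
        simp
    _ ≤ (1 + ‖z‖) * (1 + ‖z‖) * C + (1 + ‖z‖) ^ 2 := by
        gcongr
        · linarith
        · exact hC z h0 h2
        · nlinarith
    _ = (C + 1) * (1 + ‖z‖) ^ 2 := by ring
    _ ≤ _ := by gcongr

theorem norm_Gamma_le {u : ℂ} (hu : 0 < u.re) : ‖Complex.Gamma u‖ ≤ Real.Gamma u.re := by
  rw [Complex.Gamma_eq_integral hu, Real.Gamma_eq_integral hu, Complex.GammaIntegral]
  refine norm_integral_le_of_norm_le (Real.GammaIntegral_convergent hu) ?_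
  refine (ae_restrict_iff' measurableSet_Ioi).mpr (Eventually.of_forall fun t (ht : 0 < t) => ?_)
  rw [norm_mul, norm_cpow_eq_rpow_re_of_pos ht, Complex.norm_real, Real.norm_eq_abs, Real.abs_exp]
  simp

theorem exists_norm_Gammaℝ_le :
    ∃ C : ℝ, 0 < C ∧ ∀ z : ℂ, 1 ≤ z.re → z.re ≤ 3 → ‖Gammaℝ z‖ ≤ C := by
  have hc : ContinuousOn (fun x : ℝ => Real.Gamma (x / 2)) (Icc 1 3) := fun x hx => by
    have hx0 : 0 < x / 2 := by linarith [hx.1]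
    have : ContinuousAt Real.Gamma (x / 2) := (Real.differentiableAt_Gamma fun m => by
      have : (0 : ℝ) ≤ m := m.cast_nonneg
      linarith).continuousAt
    exact (ContinuousAt.comp (f := fun x : ℝ => x / 2) this (by fun_prop)).continuousWithinAt
  obtain ⟨C, hC⟩ := isCompact_Icc.exists_bound_of_continuousOn hc
  refine ⟨max C 1, by positivity, fun z h1 h3 => le_max_of_le_left ?_⟩
  have hre : (z / 2).re = z.re / 2 := by simp
  have hnre : (-z / 2).re = -z.re / 2 := by simp
  rw [Gammaℝ_def, norm_mul, norm_cpow_eq_rpow_re_of_pos Real.pi_pos, hnre]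
  have hpi : π ^ (-z.re / 2) ≤ 1 :=
    Real.rpow_le_one_of_one_le_of_nonpos (by linarith [Real.pi_gt_three]) (by linarith)
  have hG : ‖Complex.Gamma (z / 2)‖ ≤ C := by
    refine (norm_Gamma_le (by rw [hre]; linarith)).trans ?_
    rw [hre]
    exact (le_abs_self _).trans (hC z.re ⟨h1, h3⟩)
  calc _ ≤ 1 * C := mul_le_mul hpi hG (norm_nonneg _) zero_le_one
    _ = C := one_mul C

theorem norm_cos_le_exp (z : ℂ) : ‖Complex.cos z‖ ≤ Real.exp ‖z‖ := by
  rw [Complex.cos, norm_div, Complex.norm_ofNat, div_le_iff₀ two_pos]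
  refine (norm_add_le _ _).trans ?_
  have h1 := Complex.norm_exp_le_exp_norm (z * I)
  have h2 := Complex.norm_exp_le_exp_norm (-z * I)
  simp only [norm_mul, norm_I, mul_one, norm_neg] at h1 h2
  linarith

theorem exists_norm_Gammaℝ_inv_le :
    ∃ C : ℝ, 0 < C ∧ ∀ w : ℂ, 0 ≤ w.re → w.re ≤ 1 → 1 ≤ |w.im| →
      ‖(Gammaℝ (2 * w + 1))⁻¹‖ ≤ C * Real.exp (4 * ‖w‖) := by
  obtain ⟨C, hC0, hC⟩ := exists_norm_Gammaℝ_le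
  refine ⟨C * (2 * π), by positivity, fun w h0 h1 him => ?_⟩
  have hu : 1 ≤ ‖1 - 2 * w‖ := by
    refine le_trans ?_ (Complex.abs_im_le_norm _)
    simp [abs_mul]
    linarith
  have hu0 : 1 - 2 * w ≠ 0 := norm_pos_iff.mp (by linarith)
  have hpi : (π : ℂ) ≠ 0 := ofReal_ne_zero.mpr Real.pi_ne_zero
  have hG0 : Gammaℝ (2 * w + 1) ≠ 0 := Gammaℝ_ne_zero_of_re_pos (by simp; linarith)
  have h3 : Gammaℝ (3 - 2 * w) = Gammaℝ (1 - 2 * w) * (1 - 2 * w) / 2 / π := by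
    rw [← Gammaℝ_add_two hu0]
    ring_nf
  have hrefl := Gammaℝ_one_sub_mul_Gammaℝ_one_add (2 * w)
  have hne : Gammaℝ (1 - 2 * w) ≠ 0 := by
    intro h
    rw [h] at h3
    exact Gammaℝ_ne_zero_of_re_pos (s := 3 - 2 * w) (by simp; linarith) (by simpa using h3)
  have e : (Gammaℝ (2 * w + 1))⁻¹ =
      Complex.cos (π * w) * (Gammaℝ (3 - 2 * w) * (2 * π)) / (1 - 2 * w) := by
    have hc : Complex.cos (π * w) = (Gammaℝ (1 - 2 * w) * Gammaℝ (2 * w + 1))⁻¹ := by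
      rw [add_comm (2 * w), hrefl, inv_inv]
      ring_nf
    rw [hc, h3]
    field_simp
  rw [e, norm_div, norm_mul, norm_mul]
  have hcos : ‖Complex.cos (π * w)‖ ≤ Real.exp (4 * ‖w‖) := by
    refine (norm_cos_le_exp _).trans (Real.exp_le_exp.mpr ?_)
    rw [norm_mul, Complex.norm_real, Real.norm_of_nonneg Real.pi_pos.le]
    exact mul_le_mul_of_nonneg_right Real.pi_le_four (norm_nonneg _)
  have hGle := hC (3 - 2 * w) (by simp; linarith) (by simp; linarith)
  have h2pi : ‖(2 * π : ℂ)‖ = 2 * π := by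
    simp [abs_of_pos Real.pi_pos]
  rw [h2pi]
  refine (div_le_self (by positivity) hu).trans ?_
  calc _ ≤ Real.exp (4 * ‖w‖) * (C * (2 * π)) := by gcongr
    _ = _ := by ring

theorem norm_riemannZeta_le {z : ℂ} {x : ℝ} (hx : 1 < x) (hz : x ≤ z.re) :
    ‖riemannZeta z‖ ≤ ∑' n : ℕ, ‖LSeries.term 1 x n‖ := by
  have hz1 : 1 < z.re := by linarith
  rw [← LSeries_one_eq_riemannZeta hz1, LSeries]
  have hs : Summable fun n => ‖LSeries.term 1 (x : ℂ) n‖ :=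
    (LSeriesSummable_one_iff.mpr (by simpa using hx)).norm
  exact tsum_of_norm_bounded hs.hasSum fun n => LSeries.norm_term_le_of_re_le_re 1 (by simpa) n

theorem norm_riemannZeta_inv_le {z : ℂ} {x : ℝ} (hx : 1 < x) (hz : x ≤ z.re) :
    ‖(riemannZeta z)⁻¹‖ ≤ ∑' n : ℕ, ‖LSeries.term 1 x n‖ := by
  have hz1 : 1 < z.re := by linarith
  rw [← LSeries_one_eq_riemannZeta hz1,
    ← eq_inv_of_mul_eq_one_right (LSeries_one_mul_Lseries_moebius hz1), LSeries]
  have hs : Summable fun n => ‖LSeries.term 1 (x : ℂ) n‖ :=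
    (LSeriesSummable_one_iff.mpr (by simpa using hx)).norm
  refine tsum_of_norm_bounded hs.hasSum fun n =>
    (LSeries.norm_term_le_of_re_le_re _ (by simpa) n).trans (LSeries.norm_term_le _ ?_)
  have : |ArithmeticFunction.moebius n| ≤ 1 := ArithmeticFunction.abs_moebius_le_one
  simpa using (by exact_mod_cast this : |(ArithmeticFunction.moebius n : ℝ)| ≤ 1)

theorem tsum_norm_term_one {x : ℝ} (hx : 1 < x) :
    ∑' n : ℕ, ‖LSeries.term 1 (x : ℂ) n‖ = ‖riemannZeta x‖ := by
  have hz : 1 < (x : ℂ).re := by simpa using hx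
  have hs := (LSeriesSummable_one_iff.mpr hz)
  have e : ∀ n, LSeries.term 1 (x : ℂ) n = ((‖LSeries.term 1 (x : ℂ) n‖ : ℝ) : ℂ) := by
    intro n
    rcases eq_or_ne n 0 with rfl | hn
    · simp
    have hc : (n : ℂ) ^ (x : ℂ) = (((n : ℝ) ^ x : ℝ) : ℂ) := by
      rw [Complex.ofReal_cpow n.cast_nonneg, Complex.ofReal_natCast]
    have hnn : 0 ≤ (n : ℝ) ^ x := by positivity
    rw [LSeries.term_of_ne_zero hn, hc, Pi.one_apply, norm_div, Complex.norm_real,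
      Real.norm_of_nonneg hnn]
    simp
  rw [← LSeries_one_eq_riemannZeta hz, LSeries, tsum_congr e, ← Complex.ofReal_tsum,
    Complex.norm_real, Real.norm_of_nonneg (tsum_nonneg fun _ => norm_nonneg _)]

theorem exists_norm_riemannZeta_inv_le :
    ∃ C : ℝ, 0 < C ∧ ∀ z : ℂ, 1 < z.re → z.re ≤ 3 → ‖(riemannZeta z)⁻¹‖ ≤ C / (z.re - 1) := by
  have hc : Continuous fun x : ℝ => entireXi x * (Gammaℝ x)⁻¹ :=
    (differentiable_entireXi.continuous.mul differentiable_Gammaℝ_inv.continuous).comp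
      continuous_ofReal
  obtain ⟨C, hC⟩ := isCompact_Icc.exists_bound_of_continuousOn (s := Icc 1 3) hc.continuousOn
  refine ⟨max C 1, by positivity, fun z h1 h3 => ?_⟩
  refine (norm_riemannZeta_inv_le h1 le_rfl).trans ?_
  rw [tsum_norm_term_one h1, le_div_iff₀ (by linarith)]
  refine le_max_of_le_left (le_trans ?_ (hC z.re ⟨h1.le, h3⟩))
  have hx0 : ((z.re : ℝ) : ℂ) ≠ 0 := ofReal_ne_zero.mpr (by linarith)
  have hx1 : ((z.re : ℝ) : ℂ) ≠ 1 := by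
    exact_mod_cast h1.ne'
  have hG : Gammaℝ (z.re : ℂ) ≠ 0 := Gammaℝ_ne_zero_of_re_pos (by simp; linarith)
  have e : entireXi (z.re : ℂ) * (Gammaℝ (z.re : ℂ))⁻¹ =
      z.re * (((z.re - 1 : ℝ) : ℂ) * riemannZeta z.re) := by
    rw [entireXi_eq hx0 hx1, completedRiemannZeta_eq_Gammaℝ_mul (by simp; linarith)]
    push_cast
    field_simp
  rw [e, norm_mul, norm_mul, Complex.norm_real, Complex.norm_real,
    Real.norm_of_nonneg (by linarith), Real.norm_of_nonneg (by linarith), mul_comm]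
  exact le_mul_of_one_le_left (mul_nonneg (by linarith) (norm_nonneg _)) h1.le

theorem norm_betaIntegral_half_le {w : ℂ} (hw : 1 ≤ w.re) :
    ‖betaIntegral w (1 / 2)‖ ≤ ∫ x : ℝ in 0..1, (1 - x) ^ (-(1 / 2) : ℝ) := by
  have hi : IntervalIntegrable (fun x : ℝ => (1 - x) ^ (-(1 / 2) : ℝ)) volume 0 1 := by
    have h := (intervalIntegral.intervalIntegrable_rpow' (a := 1) (b := 0)
      (r := (-(1 / 2) : ℝ)) (by norm_num)).comp_sub_left 1
    simpa using h
  refine intervalIntegral.norm_integral_le_of_norm_le zero_le_one ?_ hi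
  have h1 : ∀ᵐ x : ℝ, x ≠ 1 := by simp [ae_iff, measure_singleton]
  filter_upwards [h1] with x hx1 hx
  have hx0 : 0 < x := hx.1
  have hx' : 0 < 1 - x := sub_pos.mpr (lt_of_le_of_ne hx.2 hx1)
  rw [norm_mul, norm_cpow_eq_rpow_re_of_pos hx0, ← ofReal_one, ← ofReal_sub,
    norm_cpow_eq_rpow_re_of_pos hx']
  have he : (1 / 2 - ((1 : ℝ) : ℂ)).re = -(1 / 2) := by norm_num
  rw [ofReal_one] at he ⊢
  rw [he]
  exact mul_le_of_le_one_left (by positivity)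
    (Real.rpow_le_one hx0.le hx.2 (by simpa using hw))

theorem Gammaℝ_two_mul_eq {w : ℂ} (hw : 0 < w.re) :
    Gammaℝ (2 * w) = betaIntegral w (1 / 2) * Gammaℝ (2 * w + 1) := by
  have h := Complex.Gamma_mul_Gamma_eq_betaIntegral hw (t := 1 / 2) (by norm_num)
  have hpi : (π : ℂ) ≠ 0 := ofReal_ne_zero.mpr Real.pi_ne_zero
  have hp : (π : ℂ) ^ (1 / 2 : ℂ) ≠ 0 := by simp [Complex.cpow_eq_zero_iff, hpi]
  rw [Complex.Gamma_one_half_eq] at h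
  rw [Gammaℝ_def, Gammaℝ_def, show -(2 * w) / 2 = -(2 * w + 1) / 2 + 1 / 2 by ring,
    Complex.cpow_add _ _ hpi, show 2 * w / 2 = w by ring, show (2 * w + 1) / 2 = w + 1 / 2 by ring]
  linear_combination (π : ℂ) ^ (-(2 * w + 1) / 2) * h

/-- The ratio `ξ(2w) / ξ(2w+1)`, which is bounded by `1` on the right half-plane. -/
noncomputable def xiRatio (w : ℂ) : ℂ := entireXi (2 * w) / entireXi (2 * w + 1)

theorem entireXi_two_mul_add_one_ne_zero {w : ℂ} (hw : 0 ≤ w.re) : entireXi (2 * w + 1) ≠ 0 :=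
  entireXi_ne_zero (by simp; linarith)

theorem differentiableAt_xiRatio {w : ℂ} (hw : 0 ≤ w.re) : DifferentiableAt ℂ xiRatio w := by
  have h := differentiable_entireXi
  have h0 := entireXi_two_mul_add_one_ne_zero hw
  unfold xiRatio
  fun_prop (disch := assumption)

theorem xiRatio_conj (w : ℂ) : xiRatio (conj w) = conj (xiRatio w) := by
  have h1 : 2 * conj w = conj (2 * w) := by simp [map_ofNat]
  have h2 : 2 * conj w + 1 = conj (2 * w + 1) := by simp [map_ofNat]
  rw [xiRatio, h2, h1, entireXi_conj, entireXi_conj, xiRatio, map_div₀]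

theorem norm_xiRatio_of_re_eq_zero {w : ℂ} (hw : w.re = 0) : ‖xiRatio w‖ = 1 := by
  have h : entireXi (2 * w) = conj (entireXi (2 * w + 1)) := by
    rw [← entireXi_conj, ← entireXi_one_sub]
    congr 1
    apply Complex.ext <;> simp [hw]
  rw [xiRatio, h, norm_div, RCLike.norm_conj, div_self]
  exact norm_ne_zero_iff.mpr (entireXi_two_mul_add_one_ne_zero hw.ge)

theorem exists_norm_xiRatio_le_of_one_le_re :
    ∃ C : ℝ, ∀ w : ℂ, 1 ≤ w.re → ‖xiRatio w‖ ≤ C := by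
  set Z : ℝ := ∑' n : ℕ, ‖LSeries.term 1 ((2 : ℝ) : ℂ) n‖
  set B : ℝ := ∫ x : ℝ in 0..1, (1 - x) ^ (-(1 / 2) : ℝ)
  have hZ0 : 0 ≤ Z := tsum_nonneg fun _ => norm_nonneg _
  refine ⟨1 * B * Z * Z, fun w hw => ?_⟩
  have hB0 : 0 ≤ B := (norm_nonneg _).trans (norm_betaIntegral_half_le hw)
  have hw0 : w ≠ 0 := by rintro rfl; norm_num at hw
  have h2w0 : 2 * w ≠ 0 := mul_ne_zero two_ne_zero hw0
  have h2w1 : 2 * w ≠ 1 := fun h => by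
    have := congrArg Complex.re h
    simp at this
    linarith
  have h2w2 : 2 * w + 1 ≠ 0 := fun h => by
    have := congrArg Complex.re h
    simp at this
    linarith
  have h2w3 : 2 * w + 1 ≠ 1 := by simpa using hw0
  have hG : Gammaℝ (2 * w + 1) ≠ 0 := Gammaℝ_ne_zero_of_re_pos (by simp; linarith)
  have hζ : riemannZeta (2 * w + 1) ≠ 0 :=
    riemannZeta_ne_zero_of_one_le_re (by simp; linarith)
  have e : xiRatio w = (2 * w - 1) / (2 * w + 1) * betaIntegral w (1 / 2) *
      riemannZeta (2 * w) * (riemannZeta (2 * w + 1))⁻¹ := by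
    rw [xiRatio, entireXi_eq h2w0 h2w1, entireXi_eq h2w2 h2w3,
      completedRiemannZeta_eq_Gammaℝ_mul (by simp; linarith),
      completedRiemannZeta_eq_Gammaℝ_mul (by simp; linarith), Gammaℝ_two_mul_eq (by linarith)]
    rw [show 2 * w + 1 - 1 = 2 * w by ring]
    field_simp
  have hfrac : ‖(2 * w - 1) / (2 * w + 1)‖ ≤ 1 := by
    rw [norm_div, div_le_one (norm_pos_iff.mpr h2w2), ← sq_le_sq₀ (norm_nonneg _) (norm_nonneg _),
      ← Complex.normSq_eq_norm_sq, ← Complex.normSq_eq_norm_sq, Complex.normSq_apply,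
      Complex.normSq_apply]
    simp
    nlinarith
  rw [e, norm_mul, norm_mul, norm_mul]
  gcongr
  · exact norm_betaIntegral_half_le hw
  · exact norm_riemannZeta_le one_lt_two (by simp; linarith)
  · exact norm_riemannZeta_inv_le one_lt_two (by simp; linarith)

theorem exists_norm_xiRatio_le_div_re :
    ∃ C : ℝ, 0 < C ∧ ∀ w : ℂ, 0 < w.re → w.re ≤ 1 → 1 ≤ |w.im| →
      ‖xiRatio w‖ ≤ C * Real.exp (8 * ‖w‖) / w.re := by
  obtain ⟨C₁, hC₁, h₁⟩ := exists_norm_entireXi_le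
  obtain ⟨C₂, hC₂, h₂⟩ := exists_norm_Gammaℝ_inv_le
  obtain ⟨C₃, hC₃, h₃⟩ := exists_norm_riemannZeta_inv_le
  refine ⟨C₁ * C₂ * C₃, by positivity, fun w h0 h1 him => ?_⟩
  have hz : 1 ≤ ‖2 * w + 1‖ := by
    refine le_trans ?_ (Complex.abs_im_le_norm _)
    simp [abs_mul]
    linarith
  have hz' : 1 ≤ ‖2 * w‖ := by
    refine le_trans ?_ (Complex.abs_im_le_norm _)
    simp [abs_mul]
    linarith
  have hz0 : 2 * w + 1 ≠ 0 := norm_pos_iff.mp (by linarith)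
  have hz1 : 2 * w + 1 ≠ 1 := by simpa using norm_pos_iff.mp (show 0 < ‖2 * w‖ by linarith)
  have e : xiRatio w = entireXi (2 * w) * (Gammaℝ (2 * w + 1))⁻¹ * (riemannZeta (2 * w + 1))⁻¹ /
      ((2 * w + 1) * (2 * w)) := by
    rw [xiRatio, entireXi_eq hz0 hz1, completedRiemannZeta_eq_Gammaℝ_mul (by simp; linarith),
      show 2 * w + 1 - 1 = 2 * w by ring]
    field_simp
  have b₁ := h₁ (2 * w) (by simp; linarith) (by simp; linarith)
  have b₂ := h₂ w h0.le h1 him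
  have b₃ := h₃ (2 * w + 1) (by simp; linarith) (by simp; linarith)
  rw [norm_mul, Complex.norm_ofNat, show 2 * (2 * ‖w‖) = 4 * ‖w‖ by ring] at b₁
  have b₃' : ‖(riemannZeta (2 * w + 1))⁻¹‖ ≤ C₃ / w.re := by
    refine b₃.trans ?_
    simp
    gcongr
    linarith
  rw [e, norm_div, norm_mul, norm_mul, norm_mul (2 * w + 1)]
  refine (div_le_self (by positivity) (one_le_mul_of_one_le_of_one_le hz hz')).trans ?_
  calc _ ≤ (C₁ * Real.exp (4 * ‖w‖)) * (C₂ * Real.exp (4 * ‖w‖)) * (C₃ / w.re) := by gcongr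
    _ = _ := by
      rw [show 8 * ‖w‖ = 4 * ‖w‖ + 4 * ‖w‖ by ring, Real.exp_add]
      ring

/-- The blow-up of the bound near the imaginary axis is removed by the maximum principle on a
half-disc, after multiplication by a function vanishing at its corners. -/
theorem exists_norm_xiRatio_le_exp :
    ∃ C : ℝ, ∀ w : ℂ, 0 < w.re → w.re < 1 → 2 ≤ |w.im| →
      ‖xiRatio w‖ ≤ C * Real.exp (8 * ‖w‖) := by
  obtain ⟨C, hC, hle⟩ := exists_norm_xiRatio_le_div_re
  set K : ℝ := C * 2 * Real.exp 16 + 2 with hK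
  refine ⟨K, fun w h0 h1 him => ?_⟩
  set c : ℂ := (w.im : ℂ) * I with hc
  have hcre : c.re = 0 := by simp [hc]
  have hcim : c.im = w.im := by simp [hc]
  set U : Set ℂ := ball c 1 ∩ {v | 0 < v.re} with hU
  have hUo : IsOpen U := isOpen_ball.inter (isOpen_lt continuous_const Complex.continuous_re)
  have hcl : closure U ⊆ closedBall c 1 ∩ {v | 0 ≤ v.re} :=
    closure_minimal (inter_subset_inter ball_subset_closedBall fun v (hv : 0 < v.re) => hv.le)
      (isClosed_closedBall.inter (isClosed_le continuous_const Complex.continuous_re))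
  set h : ℂ → ℂ := fun v => xiRatio v * ((v - c) ^ 2 + 1) with hh
  have hd : DiffContOnCl ℂ h U := by
    refine DifferentiableOn.diffContOnCl fun v hv => ?_
    have := differentiableAt_xiRatio (hcl hv).2
    exact DifferentiableAt.differentiableWithinAt (by fun_prop)
  have hwc : ‖w - c‖ = w.re := by
    have : w - c = (w.re : ℂ) := by apply Complex.ext <;> simp [hc]
    rw [this, Complex.norm_real, Real.norm_of_nonneg h0.le]
  have hexp1 : 1 ≤ Real.exp (8 * ‖w‖) := Real.one_le_exp (by positivity)
  have hfr : ∀ v ∈ frontier U, ‖h v‖ ≤ K * Real.exp (8 * ‖w‖) := by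
    intro v hv
    obtain ⟨hvb, hvr⟩ := hcl hv.1
    rw [mem_closedBall, dist_eq_norm] at hvb
    have hvU : v ∉ U := by
      have := hv.2
      rwa [hUo.interior_eq] at this
    rw [hh]
    simp only [norm_mul]
    have hq : ‖(v - c) ^ 2 + 1‖ ≤ 2 := by
      refine (norm_add_le _ _).trans ?_
      rw [norm_pow, norm_one]
      nlinarith [norm_nonneg (v - c)]
    rcases eq_or_lt_of_le (show 0 ≤ v.re from hvr) with hv0 | hv0
    · rw [norm_xiRatio_of_re_eq_zero hv0.symm, one_mul]
      refine hq.trans ?_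
      have : 0 < C * 2 * Real.exp 16 := by positivity
      nlinarith
    · have hv1 : ‖v - c‖ = 1 := by
        refine le_antisymm hvb (not_lt.mp fun hlt => hvU ⟨?_, hv0⟩)
        rwa [mem_ball, dist_eq_norm]
      have hre := (Complex.abs_re_le_norm (v - c)).trans hvb
      have hims := (Complex.abs_im_le_norm (v - c)).trans hvb
      rw [Complex.sub_re, hcre, sub_zero, abs_of_pos hv0] at hre
      rw [Complex.sub_im, hcim] at hims
      have hvim : 1 ≤ |v.im| := by
        have := abs_sub_abs_le_abs_sub w.im v.im
        rw [abs_sub_comm] at this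
        linarith
      have hq' : ‖(v - c) ^ 2 + 1‖ = 2 * v.re := by
        have hmc : (v - c) * conj (v - c) = 1 := by rw [Complex.mul_conj', hv1]; simp
        have e : (v - c) ^ 2 + 1 = (v - c) * ((2 * (v - c).re : ℝ) : ℂ) := by
          rw [← Complex.add_conj, mul_add, hmc]
          ring
        rw [e, norm_mul, hv1, one_mul, Complex.norm_real, Complex.sub_re, hcre, sub_zero,
          Real.norm_of_nonneg (by linarith)]
      have hvw : ‖v‖ ≤ ‖w‖ + 2 := by
        calc ‖v‖ = ‖w + ((v - c) - (w - c))‖ := by congr 1; ring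
          _ ≤ ‖w‖ + (‖v - c‖ + ‖w - c‖) :=
            (norm_add_le _ _).trans (add_le_add le_rfl (norm_sub_le _ _))
          _ ≤ _ := by linarith
      rw [hq']
      calc ‖xiRatio v‖ * (2 * v.re) ≤ C * Real.exp (8 * ‖v‖) / v.re * (2 * v.re) := by
            gcongr
            exact hle v hv0 hre hvim
        _ = C * 2 * Real.exp (8 * ‖v‖) := by field_simp
        _ ≤ C * 2 * Real.exp (16 + 8 * ‖w‖) := by gcongr; linarith
        _ = C * 2 * Real.exp 16 * Real.exp (8 * ‖w‖) := by rw [Real.exp_add]; ring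
        _ ≤ _ := by gcongr; linarith
  have hwU : w ∈ U := ⟨by rw [mem_ball, dist_eq_norm, hwc]; exact h1, h0⟩
  have hmax := Complex.norm_le_of_forall_mem_frontier_norm_le
    (isBounded_ball.subset inter_subset_left) hd hfr (subset_closure hwU)
  refine le_trans ?_ hmax
  have hsq : (w - c) ^ 2 + 1 = ((w.re ^ 2 + 1 : ℝ) : ℂ) := by
    have : w - c = (w.re : ℂ) := by apply Complex.ext <;> simp [hc]
    rw [this]
    push_cast
    rfl
  simp only [hh]
  rw [norm_mul, hsq, Complex.norm_real, Real.norm_of_nonneg (by positivity)]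
  exact le_mul_of_one_le_right (norm_nonneg _) (by nlinarith)

/-- Phragmén–Lindelöf: `xiRatio` has modulus at most `1` on the closed right half-plane. -/
theorem norm_xiRatio_le_one {w : ℂ} (hw : 0 ≤ w.re) : ‖xiRatio w‖ ≤ 1 := by
  obtain ⟨C₁, h₁⟩ := exists_norm_xiRatio_le_of_one_le_re
  obtain ⟨C₂, h₂⟩ := exists_norm_xiRatio_le_exp
  have hcl : closure {z : ℂ | 0 < z.re} ⊆ {z : ℂ | 0 ≤ z.re} :=
    closure_minimal (fun z (hz : 0 < z.re) => hz.le)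
      (isClosed_le continuous_const Complex.continuous_re)
  refine PhragmenLindelof.right_half_plane_of_bounded_on_real (f := xiRatio) ?_ ?_ ?_ ?_ hw
  · exact DifferentiableOn.diffContOnCl fun z hz =>
      (differentiableAt_xiRatio (hcl hz)).differentiableWithinAt
  · refine ⟨1, one_lt_two, 8, ?_⟩
    refine Asymptotics.IsBigO.of_bound (max C₁ C₂) ?_
    have hev : ∀ᶠ z : ℂ in cobounded ℂ, 3 ≤ ‖z‖ :=
      tendsto_norm_cobounded_atTop.eventually_ge_atTop 3
    filter_upwards [hev.filter_mono inf_le_left,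
      (mem_inf_of_right (mem_principal_self _) : {z : ℂ | 0 < z.re} ∈ _)] with z hz hz0
    replace hz0 : 0 < z.re := hz0
    rw [Real.rpow_one, Real.norm_of_nonneg (Real.exp_pos _).le]
    have hexp1 : 1 ≤ Real.exp (8 * ‖z‖) := Real.one_le_exp (by positivity)
    rcases le_or_gt 1 z.re with h | h
    · have hC := h₁ z h
      have : 0 ≤ C₁ := (norm_nonneg _).trans hC
      calc _ ≤ C₁ := hC
        _ ≤ C₁ * Real.exp (8 * ‖z‖) := le_mul_of_one_le_right this hexp1
        _ ≤ _ := by gcongr; exact le_max_left _ _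
    · refine (h₂ z hz0 h ?_).trans (by gcongr; exact le_max_right _ _)
      have := Complex.norm_le_abs_re_add_abs_im z
      rw [abs_of_pos hz0] at this
      linarith
  · refine isBoundedUnder_of_eventually_le (a := C₁) ?_
    filter_upwards [eventually_ge_atTop 1] with x hx
    exact h₁ x (by simpa using hx)
  · intro x
    exact (norm_xiRatio_of_re_eq_zero (by simp)).le

theorem phi0_one_sub (a : ℝ) (s : ℂ) : phi0 a (1 - s) = phi0 a s := by
  have h₁ : completedRiemannZeta (2 * (1 - s)) = completedRiemannZeta (2 * s - 1) := by
    rw [← completedRiemannZeta_one_sub]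
    congr 1
    ring
  have h₂ : completedRiemannZeta (2 * (1 - s) - 1) = completedRiemannZeta (2 * s) := by
    rw [← completedRiemannZeta_one_sub]
    congr 1
    ring
  rw [phi0, phi0, h₁, h₂, sub_sub_cancel, add_comm]

theorem cayley_eq_of_phi0_eq_zero {a : ℝ} (ha : 0 < a) {w : ℂ} (hre : 0 < w.re)
    (him : w.im ≠ 0) (h : phi0 a (w + 1 / 2) = 0) :
    (w + 1 / 2) * ((a : ℂ) ^ (-2 * w) * xiRatio w) = -(w - 1 / 2) := by
  have ha' : (a : ℂ) ≠ 0 := by exact_mod_cast ha.ne'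
  have hw : w ≠ 0 := by rintro rfl; simp at him
  have hp : 2 * w + 1 ≠ 0 := fun h => by simpa [him] using congrArg im h
  have hm : 2 * w - 1 ≠ 0 := fun h => by simpa [him] using congrArg im h
  have hξ := entireXi_two_mul_add_one_ne_zero hre.le
  have e₁ : entireXi (2 * w + 1) = (2 * w + 1) * (2 * w) * completedRiemannZeta (2 * w + 1) := by
    rw [entireXi_eq hp (by simpa using hw), add_sub_cancel_right]
  have e₂ : entireXi (2 * w) = 2 * w * (2 * w - 1) * completedRiemannZeta (2 * w) :=
    entireXi_eq (by simpa using hw) (sub_ne_zero.mp hm)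
  have hpow : (a : ℂ) ^ (1 - (w + 1 / 2)) = (a : ℂ) ^ (-2 * w) * (a : ℂ) ^ (w + 1 / 2) := by
    rw [← cpow_add _ _ ha']
    congr 1
    ring
  have hA : (a : ℂ) ^ (w + 1 / 2) ≠ 0 := by simp [cpow_eq_zero_iff, ha']
  have hz : completedRiemannZeta (2 * w + 1) +
      completedRiemannZeta (2 * w) * (a : ℂ) ^ (-2 * w) = 0 := by
    refine (mul_eq_zero.mp ?_).resolve_right hA
    rw [phi0, hpow, show 2 * (w + 1 / 2) = 2 * w + 1 by ring, add_sub_cancel_right] at h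
    linear_combination h
  rw [xiRatio, ← mul_assoc, ← mul_div_assoc, div_eq_iff hξ, e₁, e₂]
  linear_combination (w * (2 * w - 1) * (2 * w + 1)) * hz

theorem phi0_ne_zero_of_half_lt_re {a : ℝ} (ha : 1 ≤ a) {s : ℂ} (him : s.im ≠ 0)
    (hre : 1 / 2 < s.re) : phi0 a s ≠ 0 := by
  intro h
  have ha₀ : 0 < a := by linarith
  have ha' : (a : ℂ) ≠ 0 := by exact_mod_cast ha₀.ne'
  obtain ⟨w, rfl⟩ : ∃ w, s = w + 1 / 2 := ⟨s - 1 / 2, by ring⟩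
  have hw : 0 < w.re := by norm_num at hre; exact hre
  have hwi : w.im ≠ 0 := by norm_num at him; exact him
  set T : ℂ → ℂ := fun v => (a : ℂ) ^ (-2 * v) * xiRatio v with hT
  have hTw : (w + 1 / 2) * T w = -(w - 1 / 2) := cayley_eq_of_phi0_eq_zero ha₀ hw hwi h
  have hTconj : T (conj w) = conj (T w) := by
    have harg : (a : ℂ).arg ≠ Real.pi := by
      rw [arg_ofReal_of_nonneg ha₀.le]
      exact Real.pi_ne_zero.symm
    have := cpow_conj (a : ℂ) (-2 * w) harg
    simp only [map_mul, map_neg, conj_ofReal, map_ofNat] at this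
    simp only [hT, map_mul, xiRatio_conj, this]
  have hTw' : (conj w + 1 / 2) * T (conj w) = -(conj w - 1 / 2) := by
    rw [hTconj]
    simpa only [map_mul, map_add, map_sub, map_neg, map_div₀, map_one, map_ofNat] using
      congrArg conj hTw
  have hne : w ≠ conj w := fun h => hwi (conj_eq_iff_im.mp h.symm)
  have hzero : T (1 / 2) = 0 := by
    refine apply_half_eq_zero_of_eq_cayley (fun v hv => ?_) (fun v hv => ?_) hw
      (by simpa using hw) hne hTw hTw'
    · refine DifferentiableAt.differentiableWithinAt (DifferentiableAt.mul ?_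
        (differentiableAt_xiRatio (le_of_lt hv)))
      exact DifferentiableAt.const_cpow (by fun_prop) (Or.inl ha')
    · rw [hT, norm_mul, norm_cpow_eq_rpow_re_of_pos ha₀]
      refine mul_le_one₀ (Real.rpow_le_one_of_one_le_of_nonpos ha ?_) (norm_nonneg _)
        (norm_xiRatio_le_one hv.le)
      simp
      exact hv.le
  simp only [hT, xiRatio, mul_eq_zero, div_eq_zero_iff, cpow_eq_zero_iff] at hzero
  rcases hzero with h | h | h
  · exact ha' h.1
  · exact entireXi_ne_zero (by norm_num) h
  · exact entireXi_ne_zero (by norm_num) h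

end

/-- For every `a ≥ 1`, every non-real zero of `φ₀(a,·)` lies on the critical line
`Re(s) = 1/2`. -/
theorem phi0_nonreal_zeros_on_critical_line (a : ℝ) (ha : 1 ≤ a) (s : ℂ)
    (hs : s.im ≠ 0) (hzero : phi0 a s = 0) : s.re = 1 / 2 := by
  rcases lt_trichotomy s.re (1 / 2) with h | h | h
  · refine absurd ((phi0_one_sub a s).trans hzero)
      (phi0_ne_zero_of_half_lt_re ha (by simpa using hs) ?_)
    rw [sub_re, one_re]
    linarith
  · exact h
  · exact absurd hzero (phi0_ne_zero_of_half_lt_re ha hs h)
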